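/- arXiv:1911.00112 — 2 statements merged into one kernel-verified Lean document; each statement's English description precedes it below -/
import Mathlib

section
/- Let p be a prime number and let e be a natural number with e ≥ p − 1. Then it is NOT the case that the sequence n ↦ (n : ℝ)/e − (padicValNat p (n!) : ℝ) tends to +∞ as n → ∞. (Indeed, along the subsequence n = p^k the value is at most 1/(p−1).) -/
open Filter

/-- Legendre's formula at a prime power. -/
theorem sub_one_mul_padicValNat_factorial_prime_pow {p : ℕ} (hp : p.Prime) (k : ℕ) :
    (p - 1) * padicValNat p (Nat.factorial (p ^ k)) = p ^ k - 1 := by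
  have := Fact.mk hp
  have hdigits := Nat.digits_base_pow_mul (k := k) hp.one_lt one_pos
  rw [mul_one, Nat.digits_of_lt p 1 one_ne_zero hp.one_lt] at hdigits
  rw [sub_one_mul_padicValNat_factorial, hdigits]
  simp

theorem prime_pow_div_sub_padicValNat_factorial_le {p e : ℕ} (hp : p.Prime) (he : p - 1 ≤ e)
    (k : ℕ) :
    ((p ^ k : ℕ) : ℝ) / e - (padicValNat p (Nat.factorial (p ^ k)) : ℝ) ≤
      1 / ((p - 1 : ℕ) : ℝ) := by
  have hpos : (0 : ℝ) < ((p - 1 : ℕ) : ℝ) := by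
    exact_mod_cast Nat.sub_pos_of_lt hp.one_lt
  have hle : ((p ^ k : ℕ) : ℝ) / e ≤ ((p ^ k : ℕ) : ℝ) / ((p - 1 : ℕ) : ℝ) := by
    gcongr
  have hval : ((p - 1 : ℕ) : ℝ) * (padicValNat p (Nat.factorial (p ^ k)) : ℝ) + 1
      = ((p ^ k : ℕ) : ℝ) := by
    have h := sub_one_mul_padicValNat_factorial_prime_pow hp k
    have hpow : 0 < p ^ k := pow_pos hp.pos k
    exact_mod_cast (by omega :
      (p - 1) * padicValNat p (Nat.factorial (p ^ k)) + 1 = p ^ k)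
  have hdiv : ((p ^ k : ℕ) : ℝ) / ((p - 1 : ℕ) : ℝ)
      = (padicValNat p (Nat.factorial (p ^ k)) : ℝ) + 1 / ((p - 1 : ℕ) : ℝ) := by
    rw [← hval]
    field_simp
  linarith

/-- Divergence claim behind Proposition 4.2(2): if `e ≥ p − 1` then
`n/e − v_p(n!)` does NOT tend to `+∞` as `n → ∞`. -/
theorem stmt_5 (p : ℕ) (hp : Nat.Prime p) (e : ℕ) (he : p - 1 ≤ e) :
    ¬ Tendsto (fun n : ℕ => (n : ℝ) / e - (padicValNat p (Nat.factorial n) : ℝ))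
      atTop atTop := by
  intro h
  obtain ⟨k, hk⟩ := ((h.comp (tendsto_pow_atTop_atTop_of_one_lt hp.one_lt)).eventually_gt_atTop
    (1 / ((p - 1 : ℕ) : ℝ))).exists
  exact hk.not_ge (prime_pow_div_sub_padicValNat_factorial_le hp he k)
end

section
/- Let p ≥ 3 be a prime. For a ∈ ℚ_p with ‖a‖_p = 1 define ψ(a) := (1/p)·Σ'_{n∈ℕ} (−1)^n (a^{1−p} − 1)^n / n (a convergent series in ℚ_p, with the n = 0 term zero by the convention 1/0 = 0). Then for all a, b ∈ ℚ_p with ‖a‖_p = ‖b‖_p = 1 one has ψ(a·b) = ψ(a) + ψ(b). -/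
open Filter Topology

section PadicLog

variable {p : ℕ} [Fact p.Prime]

/-- Fermat's little theorem for `p`-adic units. -/
lemma Padic.norm_pow_sub_one_lt_one {a : ℚ_[p]} (ha : ‖a‖ = 1) : ‖a ^ (p - 1) - 1‖ < 1 := by
  let z : ℤ_[p] := ⟨a, ha.le⟩
  have hz : PadicInt.toZMod z ≠ 0 := by
    intro h
    rw [← RingHom.mem_ker, PadicInt.ker_toZMod, IsLocalRing.mem_maximalIdeal,
      PadicInt.mem_nonunits] at h
    exact h.ne ha
  have h : z ^ (p - 1) - 1 ∈ RingHom.ker (PadicInt.toZMod (p := p)) := by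
    rw [RingHom.mem_ker, map_sub, map_pow, map_one, ZMod.pow_card_sub_one_eq_one hz, sub_self]
  rw [PadicInt.ker_toZMod, IsLocalRing.mem_maximalIdeal, PadicInt.mem_nonunits] at h
  exact_mod_cast h

lemma Padic.norm_zpow_one_sub_sub_one_lt_one {a : ℚ_[p]} (ha : ‖a‖ = 1) :
    ‖a ^ ((1 : ℤ) - p) - 1‖ < 1 := by
  have h1 : ((1 : ℤ) - p) = -((p - 1 : ℕ) : ℤ) := by
    have := (Fact.out : p.Prime).one_le
    omega
  rw [h1, zpow_neg, zpow_natCast, ← inv_pow]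
  exact Padic.norm_pow_sub_one_lt_one (by rw [norm_inv, ha, inv_one])

lemma Padic.tendsto_natCast_pow_zero :
    Tendsto (fun k : ℕ => ((p ^ k : ℕ) : ℚ_[p])) atTop (𝓝 0) := by
  push_cast
  exact tendsto_pow_atTop_nhds_zero_of_norm_lt_one Padic.norm_p_lt_one

lemma Padic.norm_natCast_inv_le (n : ℕ) : ‖((n : ℚ_[p]))⁻¹‖ ≤ n := by
  rcases eq_or_ne n 0 with rfl | hn
  · simp
  rw [norm_inv, Padic.norm_eq_zpow_neg_valuation (by exact_mod_cast hn), ← zpow_neg, neg_neg,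
    Padic.valuation_natCast, zpow_natCast]
  exact_mod_cast Nat.le_of_dvd (Nat.pos_of_ne_zero hn) pow_padicValNat_dvd

lemma Padic.choose_succ_div {N : ℕ} (hN : N ≠ 0) (j : ℕ) :
    (N.choose (j + 1) : ℚ_[p]) = N * ((N - 1).choose j / ((j + 1 : ℕ) : ℚ_[p])) := by
  obtain ⟨m, rfl⟩ := Nat.exists_eq_succ_of_ne_zero hN
  have h : ((j + 1 : ℕ) : ℚ_[p]) ≠ 0 := by exact_mod_cast j.succ_ne_zero
  rw [mul_div_assoc', eq_div_iff h]
  exact_mod_cast (Nat.add_one_mul_choose_eq m j).symm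

lemma Padic.tendsto_choose_pow_sub_one (j : ℕ) :
    Tendsto (fun k : ℕ => ((p ^ k - 1).choose j : ℚ_[p])) atTop (𝓝 ((-1) ^ j)) := by
  have hp0 := (Fact.out : p.Prime).ne_zero
  induction j with
  | zero => simp
  | succ j ih =>
    have h := (Padic.tendsto_natCast_pow_zero (p := p)).mul (ih.div_const ((j + 1 : ℕ) : ℚ_[p]))
    have h' := h.sub ih
    rw [zero_mul, zero_sub, ← neg_one_mul, ← pow_succ'] at h'
    refine h'.congr fun k => ?_
    rw [← Padic.choose_succ_div (pow_ne_zero k hp0) j, sub_eq_iff_eq_add]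
    obtain ⟨m, hm⟩ := Nat.exists_eq_succ_of_ne_zero (pow_ne_zero k hp0)
    rw [hm, Nat.succ_sub_one, Nat.choose_succ_succ]
    push_cast
    ring

/-- The `p`-adic logarithm series as a limit of difference quotients at `0` of `s ↦ u ^ s`. -/
lemma Padic.tendsto_pow_sub_one_div {u : ℚ_[p]} (hu : ‖u - 1‖ < 1) :
    Tendsto (fun k : ℕ => (u ^ (p ^ k) - 1) / ((p ^ k : ℕ) : ℚ_[p])) atTop
      (𝓝 (-∑' n : ℕ, (-1) ^ n * (u - 1) ^ n / (n : ℚ_[p]))) := by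
  have hp0 := (Fact.out : p.Prime).ne_zero
  set x := u - 1 with hx
  have hbound : Summable fun n : ℕ => (n : ℝ) * ‖x‖ ^ n := by
    simpa using summable_pow_mul_geometric_of_norm_lt_one 1 (r := ‖x‖) (by simpa using hu)
  have hle : ∀ (c : ℚ_[p]) (n : ℕ), ‖c‖ ≤ 1 → ‖c * x ^ n / (n : ℚ_[p])‖ ≤ n * ‖x‖ ^ n := by
    intro c n hc
    rw [div_eq_mul_inv, norm_mul, norm_mul, norm_pow, mul_comm]
    exact mul_le_mul (Padic.norm_natCast_inv_le n)
      (mul_le_of_le_one_left (by positivity) hc) (by positivity) (by positivity)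
  have hlim : Tendsto
      (fun k : ℕ => ∑' n : ℕ, ((p ^ k - 1).choose n : ℚ_[p]) * x ^ (n + 1) / ((n + 1 : ℕ) : ℚ_[p]))
      atTop (𝓝 (∑' n : ℕ, (-1) ^ n * x ^ (n + 1) / ((n + 1 : ℕ) : ℚ_[p]))) := by
    refine tendsto_tsum_of_dominated_convergence ((summable_nat_add_iff 1).mpr hbound)
      (fun n => ((Padic.tendsto_choose_pow_sub_one n).mul_const _).div_const _)
      (Eventually.of_forall fun k n => hle _ (n + 1) ?_)
    exact_mod_cast Padic.norm_int_le_one (p := p) ((p ^ k - 1).choose n : ℤ)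
  have hsum : Summable fun n : ℕ => (-1) ^ n * x ^ n / (n : ℚ_[p]) :=
    Summable.of_norm_bounded hbound fun n => hle _ n (by simp)
  have hval : (∑' n : ℕ, (-1) ^ n * x ^ (n + 1) / ((n + 1 : ℕ) : ℚ_[p])) =
      -∑' n : ℕ, (-1) ^ n * x ^ n / (n : ℚ_[p]) := by
    rw [hsum.tsum_eq_zero_add, Nat.cast_zero, div_zero, zero_add, ← tsum_neg]
    exact tsum_congr fun n => by ring
  rw [← hval]
  refine hlim.congr fun k => ?_
  have hN := pow_ne_zero k hp0
  have hN' : ((p ^ k : ℕ) : ℚ_[p]) ≠ 0 := by exact_mod_cast hN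
  rw [tsum_eq_sum (s := Finset.range (p ^ k)), eq_div_iff hN', Finset.sum_mul]
  · have hux : u = x + 1 := by rw [hx]; ring
    rw [hux, add_pow, Finset.sum_range_succ']
    simp only [one_pow, mul_one, pow_zero, Nat.choose_zero_right, Nat.cast_one, add_sub_cancel_right]
    refine Finset.sum_congr rfl fun j _ => ?_
    rw [Padic.choose_succ_div hN j]
    ring
  · intro n hn
    rw [Finset.mem_range, not_lt] at hn
    rw [Nat.choose_eq_zero_of_lt (by have := Nat.pos_of_ne_zero hN; omega)]
    simp

lemma Padic.tsum_log_mul {u v : ℚ_[p]} (hu : ‖u - 1‖ < 1) (hv : ‖v - 1‖ < 1) :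
    ∑' n : ℕ, (-1) ^ n * (u * v - 1) ^ n / (n : ℚ_[p]) =
      ∑' n : ℕ, (-1) ^ n * (u - 1) ^ n / (n : ℚ_[p]) +
        ∑' n : ℕ, (-1) ^ n * (v - 1) ^ n / (n : ℚ_[p]) := by
  have hp0 := (Fact.out : p.Prime).ne_zero
  have huv : ‖u * v - 1‖ < 1 := by
    have hu1 : ‖u‖ ≤ 1 := by
      rw [← sub_add_cancel u 1]
      exact (Padic.nonarchimedean _ _).trans (max_le hu.le norm_one.le)
    have h : u * v - 1 = u * (v - 1) + (u - 1) := by ring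
    rw [h]
    refine (Padic.nonarchimedean _ _).trans_lt (max_lt ?_ hu)
    rw [norm_mul]
    exact (mul_le_of_le_one_left (norm_nonneg _) hu1).trans_lt hv
  have Hu := Padic.tendsto_pow_sub_one_div hu
  have Hv := Padic.tendsto_pow_sub_one_div hv
  have H := (((Padic.tendsto_natCast_pow_zero (p := p)).mul Hu).mul Hv).add (Hu.add Hv)
  have key := tendsto_nhds_unique (Padic.tendsto_pow_sub_one_div huv) (H.congr fun k => by
    have hN' : ((p ^ k : ℕ) : ℚ_[p]) ≠ 0 := by exact_mod_cast pow_ne_zero k hp0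
    rw [mul_pow]
    field_simp
    ring)
  linear_combination -key

end PadicLog


/-- The basic δ-character `ψ(a) = (1/p)·Σ' (−1)ⁿ (a^{1−p} − 1)ⁿ / n` of `𝔾ₘ`,
restricted to unramified points, is a group homomorphism:
`ψ(a·b) = ψ(a) + ψ(b)` for `a, b ∈ ℤ_p^×`. -/
theorem stmt_7 (p : ℕ) [Fact (Nat.Prime p)] (hp : 3 ≤ p)
    (ψ : ℚ_[p] → ℚ_[p])
    (hψ : ∀ a : ℚ_[p], ‖a‖ = 1 →
      ψ a = (1 / (p : ℚ_[p])) *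
        ∑' n : ℕ, (-1) ^ n * (a ^ ((1 : ℤ) - (p : ℤ)) - 1) ^ n / (n : ℚ_[p])) :
    ∀ a b : ℚ_[p], ‖a‖ = 1 → ‖b‖ = 1 → ψ (a * b) = ψ a + ψ b := by
  intro a b ha hb
  rw [hψ a ha, hψ b hb, hψ (a * b) (by rw [norm_mul, ha, hb, one_mul]), mul_zpow,
    Padic.tsum_log_mul (Padic.norm_zpow_one_sub_sub_one_lt_one ha)
      (Padic.norm_zpow_one_sub_sub_one_lt_one hb), mul_add]
end
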